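/- Let (X, x₀) be a pointed topological space, I a finite set, and A an abelian group regarded as a discrete space. If X is pointed homotopy equivalent to the pointed finite discrete space I₊ = I ⊔ {+} (with basepoint +), then Sym(X;A) is homotopy equivalent to the discrete space A^I. In particular, if X is a disjoint union of m + 1 open sets each homotopy equivalent to a point, with the basepoint in one of them, then Sym(X;A) is homotopy equivalent to the discrete space A^m. -/

import Mathlib

/-- Underlying set of the infinite symmetric product: finitely supported
labelings of `M` by `A` vanishing at the basepoint `m₀`. -/
def SymProd (M : Type) (A : Type) [AddCommGroup A] (m₀ : M) : Type := {l : M →₀ A // l m₀ = 0}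

/-- The structure maps `Mⁿ × Aⁿ → SymProd(M;A)`. -/
noncomputable def symF (M : Type) (A : Type) [AddCommGroup A] (m₀ : M) (n : ℕ)
    (c : Fin n → M) (a : Fin n → A) : SymProd M A m₀ :=
  ⟨(∑ i, Finsupp.single (c i) (a i)) - Finsupp.single m₀ ((∑ i, Finsupp.single (c i) (a i)) m₀),
    by simp⟩

/-- The topology on `SymProd(M;A)`: the finest topology making all structure maps
continuous, where `Mⁿ` has the product topology and `Aⁿ` the product of discrete
topologies. -/
noncomputable instance symTop (M : Type) [TopologicalSpace M] (A : Type) [AddCommGroup A]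
    (m₀ : M) : TopologicalSpace (SymProd M A m₀) :=
  ⨆ n : ℕ, TopologicalSpace.coinduced
    (fun p : (Fin n → M) × (Fin n → A) => symF M A m₀ n p.1 p.2)
    (@instTopologicalSpaceProd _ _ inferInstance
      (@Pi.topologicalSpace (Fin n) (fun _ => A) (fun _ => ⊥)))

/-- The basepoint of `SymProd(M;A)`: the zero labeling. -/
def symZero (M : Type) (A : Type) [AddCommGroup A] (m₀ : M) : SymProd M A m₀ := ⟨0, by simp⟩

/-- The pushforward `SymProd(f;A)` of a pointed map `f`. -/
noncomputable def symMap {M Y : Type} (A : Type) [AddCommGroup A] (f : M → Y)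
    (m₀ : M) (y₀ : Y) (l : SymProd M A m₀) : SymProd Y A y₀ :=
  ⟨Finsupp.mapDomain f l.1 - Finsupp.single y₀ (Finsupp.mapDomain f l.1 y₀), by simp⟩

/-- Pointed homotopy of pointed maps. -/
def PtdHomotopic {X Y : Type} [TopologicalSpace X] [TopologicalSpace Y]
    (x₀ : X) (y₀ : Y) (f g : X → Y) : Prop :=
  ∃ H : X × unitInterval → Y, Continuous H ∧ (∀ x, H (x, 0) = f x) ∧ (∀ x, H (x, 1) = g x) ∧
    ∀ t, H (x₀, t) = y₀


/-- The reduction homomorphism killing the label at the basepoint. -/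
noncomputable def redHom (M A : Type) [AddCommGroup A] (m₀ : M) : (M →₀ A) →+ (M →₀ A) :=
  AddMonoidHom.id _ - (Finsupp.singleAddHom m₀).comp (Finsupp.applyAddHom m₀)

lemma redHom_apply (M A : Type) [AddCommGroup A] (m₀ : M) (l : M →₀ A) :
    redHom M A m₀ l = l - Finsupp.single m₀ (l m₀) := rfl

/-- Class of a labeling. -/
noncomputable def symQ (M A : Type) [AddCommGroup A] (m₀ : M) (l : M →₀ A) : SymProd M A m₀ :=
  ⟨redHom M A m₀ l, by simp [redHom_apply]⟩

lemma symQ_val {M A : Type} [AddCommGroup A] {m₀ : M} (l : SymProd M A m₀) :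
    symQ M A m₀ l.1 = l := by
  apply Subtype.ext
  simp [symQ, redHom_apply, l.2]

lemma symF_eq (M A : Type) [AddCommGroup A] (m₀ : M) (n : ℕ) (c : Fin n → M) (a : Fin n → A) :
    symF M A m₀ n c a = symQ M A m₀ (∑ i, Finsupp.single (c i) (a i)) := rfl

lemma continuous_symF (M : Type) [TopologicalSpace M] (A : Type) [AddCommGroup A]
    [TopologicalSpace A] [hA : DiscreteTopology A] (m₀ : M) (n : ℕ) :
    Continuous (fun p : (Fin n → M) × (Fin n → A) => symF M A m₀ n p.1 p.2) := by
  obtain rfl := hA.eq_bot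
  rw [continuous_iff_coinduced_le]
  exact le_iSup (fun n : ℕ => TopologicalSpace.coinduced
    (fun p : (Fin n → M) × (Fin n → A) => symF M A m₀ n p.1 p.2)
    (@instTopologicalSpaceProd _ _ inferInstance
      (@Pi.topologicalSpace (Fin n) (fun _ => A) (fun _ => ⊥)))) n

lemma continuous_symF_comp (M : Type) [TopologicalSpace M] (A : Type) [AddCommGroup A]
    [TopologicalSpace A] [DiscreteTopology A] (m₀ : M) (n : ℕ) {Z : Type} [TopologicalSpace Z]
    (f : Z → Fin n → M) (g : Z → Fin n → A) (hf : Continuous f) (hg : Continuous g) :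
    Continuous (fun z => symF M A m₀ n (f z) (g z)) :=
  (continuous_symF M A m₀ n).comp (hf.prodMk hg)

lemma continuous_of_symF (M : Type) [TopologicalSpace M] (A : Type) [AddCommGroup A]
    [TopologicalSpace A] [hA : DiscreteTopology A] (m₀ : M) {Z : Type} [TopologicalSpace Z]
    (g : SymProd M A m₀ → Z)
    (hg : ∀ n : ℕ, Continuous (fun p : (Fin n → M) × (Fin n → A) => g (symF M A m₀ n p.1 p.2))) :
    Continuous g := by
  obtain rfl := hA.eq_bot
  unfold symTop
  rw [continuous_iSup_dom]
  intro n
  rw [continuous_coinduced_dom]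
  exact hg n

/-- Difference pushforward. -/
noncomputable def difHom {M Y : Type} (A : Type) [AddCommGroup A] (f : M → Y) (m₀ : M) :
    (M →₀ A) →+ (Y →₀ A) :=
  Finsupp.liftAddHom (fun x => Finsupp.singleAddHom (f x) - Finsupp.singleAddHom (f m₀))

lemma difHom_single {M Y : Type} (A : Type) [AddCommGroup A] (f : M → Y) (m₀ : M) (x : M) (a : A) :
    difHom A f m₀ (Finsupp.single x a) = Finsupp.single (f x) a - Finsupp.single (f m₀) a := by
  simp [difHom]

lemma difHom_red {M Y : Type} (A : Type) [AddCommGroup A] (f : M → Y) (m₀ : M) (l : M →₀ A) :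
    difHom A f m₀ (redHom M A m₀ l) = difHom A f m₀ l := by
  rw [redHom_apply, map_sub, difHom_single]; simp

/-- Sum of labels over fibres. -/
noncomputable def fibHom {X I : Type} (A : Type) [AddCommGroup A] (p : X → Option I) :
    (X →₀ A) →+ (I → A) :=
  open Classical in
  Finsupp.liftAddHom (fun x =>
    Option.elim (p x) 0 (fun i => AddMonoidHom.single (fun _ : I => A) i))

lemma fibHom_single {X I : Type} (A : Type) [AddCommGroup A] (p : X → Option I) (x : X) (a : A)
    (i : I) : fibHom A p (Finsupp.single x a) i =
      (open Classical in if p x = some i then a else 0) := by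
  classical
  rcases h : p x with _ | j
  · simp [fibHom, h]
  · by_cases hj : i = j
    · subst hj; simp [fibHom, h]
    · simp [fibHom, h, hj, Ne.symm hj]

/-- Labels placed at sections. -/
noncomputable def secHom {X I : Type} [Fintype I] (A : Type) [AddCommGroup A] (s : Option I → X) :
    (I → A) →+ (X →₀ A) :=
  ∑ i, (Finsupp.singleAddHom (s (some i)) - Finsupp.singleAddHom (s none) : A →+ (X →₀ A)).comp
    (Pi.evalAddMonoidHom (fun _ : I => A) i)

lemma secHom_apply {X I : Type} [Fintype I] (A : Type) [AddCommGroup A] (s : Option I → X)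
    (v : I → A) : secHom A s v =
      ∑ i, (Finsupp.single (s (some i)) (v i) - Finsupp.single (s none) (v i)) := by
  simp [secHom]

lemma exists_symF {X A : Type} [AddCommGroup A] {x₀ : X} (l : SymProd X A x₀) :
    ∃ n c a, l = symF X A x₀ n c a := by
  classical
  let e := l.1.support.equivFin
  refine ⟨_, fun i => (e.symm i : X), fun i => l.1 (e.symm i), ?_⟩
  rw [symF_eq]
  conv_lhs => rw [← symQ_val l]
  congr 1
  rw [Equiv.sum_comp e.symm (fun x : l.1.support => Finsupp.single (x : X) (l.1 x)),
    Finset.sum_coe_sort l.1.support (fun x => Finsupp.single x (l.1 x))]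
  exact (Finsupp.sum_single l.1).symm

lemma continuous_homotopy_of_symF (X : Type) [TopologicalSpace X] (A : Type) [AddCommGroup A]
    [TopologicalSpace A] [DiscreteTopology A] (x₀ : X) {Z : Type} [TopologicalSpace Z]
    (F : SymProd X A x₀ → unitInterval → Z)
    (hFc : ∀ n, Continuous (fun q : ((Fin n → X) × (Fin n → A)) × unitInterval =>
      F (symF X A x₀ n q.1.1 q.1.2) q.2)) :
    Continuous (fun q : SymProd X A x₀ × unitInterval => F q.1 q.2) := by
  have hFt : ∀ l, Continuous (F l) := by
    intro l
    obtain ⟨n, c, a, rfl⟩ := exists_symF l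
    have h1 : Continuous (fun t : unitInterval => ((c, a), t)) := by fun_prop
    exact (hFc n).comp h1
  have hG : Continuous (fun l => (⟨F l, hFt l⟩ : C(unitInterval, Z))) := by
    apply continuous_of_symF
    intro n
    exact (ContinuousMap.curry ⟨_, hFc n⟩).continuous
  exact ContinuousMap.continuous_uncurry_of_continuous ⟨_, hG⟩

theorem symProd_main (X : Type) [TopologicalSpace X] (x₀ : X) (A : Type) [AddCommGroup A]
    [TopologicalSpace A] [DiscreteTopology A] (I : Type) [Finite I]
    (p : X → Option I) (s : Option I → X) (hp : IsLocallyConstant p) (hp0 : p x₀ = none)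
    (hps : ∀ i, p (s i) = i) (H : X × unitInterval → X) (hH : Continuous H)
    (H0 : ∀ x, H (x, 0) = x) (H1 : ∀ x, H (x, 1) = s (p x)) :
    Nonempty (ContinuousMap.HomotopyEquiv (SymProd X A x₀) (I → A)) := by
  classical
  have := Fintype.ofFinite I
  have hfr : ∀ l, fibHom A p (redHom X A x₀ l) = fibHom A p l := by
    intro l
    rw [redHom_apply, map_sub]
    ext i
    simp [fibHom_single, hp0]
  let φ : C(SymProd X A x₀, I → A) := ⟨fun l => fibHom A p l.1, by
    apply continuous_of_symF
    intro n
    refine continuous_pi fun j => ?_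
    have : (fun q : (Fin n → X) × (Fin n → A) => fibHom A p (symF X A x₀ n q.1 q.2).1 j)
        = fun q => ∑ i, if p (q.1 i) = some j then q.2 i else 0 := by
      funext q
      rw [symF_eq]
      simp only [symQ, hfr, map_sum, Finset.sum_apply, fibHom_single]
    rw [this]
    refine continuous_finsetSum _ fun i _ => ?_
    have hl : IsLocallyConstant (fun x => decide (p x = some j)) := hp.comp (fun y => decide (y = some j))
    have hc : Continuous (fun q : Bool × A => if q.1 = true then q.2 else 0) :=
      continuous_of_discreteTopology
    have := hc.comp ((hl.continuous.comp ((continuous_apply i).comp continuous_fst)).prodMk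
      ((continuous_apply i).comp continuous_snd) :
        Continuous fun q : (Fin n → X) × (Fin n → A) => (decide (p (q.1 i) = some j), q.2 i))
    simpa [Function.comp_def] using this⟩
  let ψ : C(I → A, SymProd X A x₀) := ⟨fun v => symQ X A x₀ (secHom A s v),
    continuous_of_discreteTopology⟩
  have hφψ : φ.comp ψ = ContinuousMap.id _ := by
    ext v i
    change fibHom A p (redHom X A x₀ _) i = v i
    rw [hfr, secHom_apply]
    simp [fibHom_single, hps]
  -- the homotopy
  let F : SymProd X A x₀ → unitInterval → SymProd X A x₀ := fun l t =>
    symQ X A x₀ (difHom A (fun x => H (x, t)) x₀ l.1)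
  have hFs : ∀ n c a t, F (symF X A x₀ n c a) t =
      symF X A x₀ (n + n) (Fin.append (fun i => H (c i, t)) (fun _ => H (x₀, t)))
        (Fin.append a (-a)) := by
    intro n c a t
    rw [symF_eq, symF_eq]
    change symQ X A x₀ (difHom A _ x₀ (redHom X A x₀ _)) = _
    rw [difHom_red]
    congr 1
    rw [map_sum, Fin.sum_univ_add]
    simp only [difHom_single, Fin.append_left, Fin.append_right, Pi.neg_apply, Finsupp.single_neg]
    rw [Finset.sum_sub_distrib, Finset.sum_neg_distrib, sub_eq_add_neg]
  have hFc : ∀ n, Continuous (fun q : ((Fin n → X) × (Fin n → A)) × unitInterval =>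
      F (symF X A x₀ n q.1.1 q.1.2) q.2) := by
    intro n
    simp only [hFs]
    have h1 : Continuous (fun q : ((Fin n → X) × (Fin n → A)) × unitInterval =>
      ((Fin.append (fun i => H (q.1.1 i, q.2)) (fun _ : Fin n => H (x₀, q.2)) : Fin (n + n) → X),
        (Fin.append q.1.2 (-q.1.2) : Fin (n + n) → A))) := by
      refine Continuous.prodMk (continuous_pi fun i => ?_) (continuous_pi fun i => ?_)
      · refine Fin.addCases (fun i => ?_) (fun i => ?_) i
        · simp only [Fin.append_left]; fun_prop
        · simp only [Fin.append_right]; fun_prop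
      · refine Fin.addCases (fun i => ?_) (fun i => ?_) i
        · simp only [Fin.append_left]; fun_prop
        · simp only [Fin.append_right, Pi.neg_apply]
          exact (continuous_of_discreteTopology (f := fun a : A => -a)).comp (by fun_prop)
    exact continuous_symF_comp X A x₀ (n + n) _ _ h1.fst h1.snd
  have hF : Continuous (fun q : SymProd X A x₀ × unitInterval => F q.1 q.2) :=
    continuous_homotopy_of_symF X A x₀ F hFc
  have hF0 : ∀ l, F l 0 = l := by
    intro l
    conv_rhs => rw [← symQ_val l]
    apply Subtype.ext
    change (redHom X A x₀).comp (difHom A _ x₀) l.1 = redHom X A x₀ l.1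
    congr 1
    apply Finsupp.addHom_ext
    intro x a
    simp [difHom_single, H0, redHom_apply]
  have hF1 : ∀ l, F l 1 = ψ (φ l) := by
    intro l
    apply Subtype.ext
    change redHom X A x₀ (difHom A _ x₀ l.1) = redHom X A x₀ (((secHom A s).comp (fibHom A p)) l.1)
    congr 2
    apply Finsupp.addHom_ext
    intro x a
    simp only [difHom_single, H1, hp0, AddMonoidHom.comp_apply, secHom_apply, fibHom_single]
    rcases h : p x with _ | j
    · simp
    · rw [Finset.sum_eq_single j]
      · simp
      · intro b _ hb
        simp [Ne.symm hb]
      · simp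
  clear_value F φ ψ
  refine ⟨⟨φ, ψ, ?_, ?_⟩⟩
  · refine ContinuousMap.Homotopic.symm ⟨⟨⟨fun q => F q.2 q.1, hF.comp continuous_swap⟩, ?_, ?_⟩⟩
    · intro l; exact hF0 l
    · intro l; exact hF1 l
  · rw [hφψ]

theorem exists_contraction (Y : Type) [TopologicalSpace Y]
    (h : Nonempty (ContinuousMap.HomotopyEquiv Y Unit)) :
    ∃ (y : Y) (H : Y × unitInterval → Y), Continuous H ∧ (∀ x, H (x, 0) = x) ∧
      (∀ x, H (x, 1) = y) := by
  obtain ⟨e⟩ := h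
  obtain ⟨K⟩ := e.left_inv.symm
  refine ⟨e.invFun (), fun q => K (q.2, q.1), by fun_prop, ?_, ?_⟩
  · intro x; simp
  · intro x; simp

/-- If a pointed space `(X,x₀)` is pointed homotopy equivalent to the
pointed finite discrete space `I₊ = I ⊔ {+}` (modeled as `Option I`, basepoint `none`,
with the discrete topology), then `Sym(X;A)` is homotopy equivalent to the discrete
space `A^I`. In particular, if `X` is a disjoint union of `m + 1` open sets each
homotopy equivalent to a point, with the basepoint in one of them, then `Sym(X;A)` is
homotopy equivalent to the discrete space `A^m`. -/
theorem symProd_of_homotopy_discrete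
    (X : Type) [TopologicalSpace X] (x₀ : X) (A : Type) [AddCommGroup A] :
    letI : TopologicalSpace A := ⊥
    (∀ (I : Type) [Finite I],
      letI : TopologicalSpace (Option I) := ⊥
      ∀ (f : X → Option I) (h : Option I → X),
      Continuous f → Continuous h → f x₀ = none → h none = x₀ →
      PtdHomotopic x₀ x₀ (h ∘ f) id → PtdHomotopic (none : Option I) none (f ∘ h) id →
      Nonempty (ContinuousMap.HomotopyEquiv (SymProd X A x₀) (I → A))) ∧
    (∀ (m : ℕ) (U : Fin (m + 1) → Set X),
      (∀ i, IsOpen (U i)) → (Pairwise fun i j => Disjoint (U i) (U j)) →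
      (⋃ i, U i) = Set.univ →
      (∀ i, Nonempty (ContinuousMap.HomotopyEquiv (U i) Unit)) →
      x₀ ∈ U 0 →
      Nonempty (ContinuousMap.HomotopyEquiv (SymProd X A x₀) (Fin m → A))) := by
  letI : TopologicalSpace A := ⊥
  haveI : DiscreteTopology A := ⟨rfl⟩
  refine ⟨?_, ?_⟩
  · intro I _
    letI : TopologicalSpace (Option I) := ⊥
    haveI : DiscreteTopology (Option I) := ⟨rfl⟩
    intro f h hf hh hf0 hh0 ⟨H, hH, H0, H1, _⟩ ⟨K, hK, K0, K1, _⟩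
    refine symProd_main X x₀ A I f h ((IsLocallyConstant.iff_continuous f).2 hf) hf0 ?_
      (fun q => H (q.1, unitInterval.symm q.2)) (by fun_prop) ?_ ?_
    · intro i
      have hc : Continuous (fun t : unitInterval => K (i, t)) := by fun_prop
      have := ((IsLocallyConstant.iff_continuous _).2 hc).apply_eq_of_preconnectedSpace 0 1
      simpa [K0, K1] using this
    · intro x; simp [H1]
    · intro x; simp [H0]
  · intro m U hU hd hc hh hx
    have hex : ∀ x, ∃ i, x ∈ U i := fun x => by
      have : x ∈ ⋃ i, U i := hc ▸ Set.mem_univ x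
      simpa using this
    choose q hq using hex
    have hqu : ∀ x i, x ∈ U i → q x = i := by
      intro x i hi
      by_contra hne
      exact Set.disjoint_left.1 (hd hne) (hq x) hi
    choose y H hH H0 H1 using fun i => exists_contraction (U i) (hh i)
    have hql : IsLocallyConstant q := by
      rw [IsLocallyConstant.iff_eventually_eq]
      intro x
      filter_upwards [(hU (q x)).mem_nhds (hq x)] with z hz using hqu z _ hz
    let e := finSuccEquiv m
    have key : ∀ i x t (hi : x ∈ U i),
        (H (q x) (⟨x, hq x⟩, t) : X) = (H i (⟨x, hi⟩, t) : X) := by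
      intro i x t hi
      obtain rfl := hqu x i hi
      rfl
    refine symProd_main X x₀ A (Fin m) (fun x => e (q x)) (fun j => y (e.symm j)) (hql.comp e) ?_ ?_
      (fun z => (H (q z.1) (⟨z.1, hq z.1⟩, z.2) : X)) ?_ ?_ ?_
    · simp [hqu x₀ 0 hx, e]
    · intro i
      simp [hqu _ _ (y (e.symm i)).2]
    · rw [continuous_iff_continuousAt]
      rintro ⟨x, t⟩
      have ho : IsOpen (U (q x) ×ˢ (Set.univ : Set unitInterval)) := (hU _).prod isOpen_univ
      refine ContinuousOn.continuousAt (s := U (q x) ×ˢ Set.univ) ?_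
        (ho.mem_nhds ⟨hq x, trivial⟩)
      rw [continuousOn_iff_continuous_domRestrict]
      have : (U (q x) ×ˢ (Set.univ : Set unitInterval)).domRestrict
          (fun z : X × unitInterval => (H (q z.1) (⟨z.1, hq z.1⟩, z.2) : X)) =
          fun z => (H (q x) (⟨z.1.1, z.2.1⟩, z.1.2) : X) := by
        funext z
        exact key _ _ _ z.2.1
      rw [this]
      refine continuous_subtype_val.comp ((hH (q x)).comp ?_)
      fun_prop
    · intro x; simp [H0]
    · intro x; rw [H1, Equiv.symm_apply_apply]
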